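/- (Functional equation of the Hurwitz zeta function over 𝔽_q[T].) Let g ∈ 𝔽_q[T] be monic and c ∈ 𝔽_q[T]. Then for every u ∈ ℂ with 0 < |u| < 1/q, Z(u;c,g) = u^{deg g − 1} · Σ_{λ ∈ 𝔽_q^×} [ e_q(−λ)/q − 1/(q(1 − qu)) ] · D_1(1/(qu); λc/g), where D_1(·;λc/g) is evaluated via its rational continuation; equivalently, the identity holds as an equality of rational functions of u. -/

import Mathlib

open Polynomial
open scoped Classical

noncomputable section

/-- The canonical additive character of a finite field `F`:
`e_q(y) = exp(2πi·Tr(y)/p)` where `p` is the characteristic. -/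
def eChar (F : Type) [Field F] [Fintype F] (y : F) : ℂ :=
  letI : Algebra (ZMod (ringChar F)) F := ZMod.algebra F (ringChar F)
  Complex.exp (2 * Real.pi * Complex.I *
    ((Algebra.trace (ZMod (ringChar F)) F y).val : ℂ) / (ringChar F : ℂ))

variable {F : Type} [Field F] [Fintype F]

/-- `e(a/g) = e_q(coefficient of T^(deg g - 1) of (a mod g))`. -/
def eFrac (a g : Polynomial F) : ℂ :=
  eChar F ((a % g).coeff (g.natDegree - 1))

/-- Number of monic divisors of a polynomial. -/
def dCount (f : Polynomial F) : ℕ :=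
  Set.ncard {g : Polynomial F | g.Monic ∧ g ∣ f}

/-- `r_χ(f) = Σ_{g monic, g ∣ f} χ(g)`. -/
def rChi (χ : Polynomial F → ℂ) (f : Polynomial F) : ℂ :=
  ∑ᶠ g ∈ {g : Polynomial F | g.Monic ∧ g ∣ f}, χ g

/-- A Dirichlet character modulo `ℓ`: a function induced by a group homomorphism
`(F[T]/(ℓ))^× → ℂ^×`, extended by zero on non-coprime arguments. -/
def IsDirichletChar (ℓ : Polynomial F) (χ : Polynomial F → ℂ) : Prop :=
  (∀ f g : Polynomial F, f % ℓ = g % ℓ → χ f = χ g) ∧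
  (∀ f g : Polynomial F, χ (f * g) = χ f * χ g) ∧ χ 1 = 1 ∧
  ∀ f : Polynomial F, χ f = 0 ↔ ¬ IsCoprime f ℓ

/-- Primitivity: `χ` is not induced by a character modulo a proper (monic) divisor of `ℓ`. -/
def IsPrimitiveChar (ℓ : Polynomial F) (χ : Polynomial F → ℂ) : Prop :=
  IsDirichletChar ℓ χ ∧
  ∀ ℓ' : Polynomial F, ℓ'.Monic → ℓ' ∣ ℓ → ℓ' ≠ ℓ →
    ¬ ∃ χ' : Polynomial F → ℂ, IsDirichletChar ℓ' χ' ∧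
      ∀ f : Polynomial F, IsCoprime f ℓ → χ f = χ' f

/-- Complex conjugate character. -/
def conjChar (χ : Polynomial F → ℂ) : Polynomial F → ℂ := fun f => starRingEnd ℂ (χ f)

/-- `L(s,χ) = Σ_{f monic} χ(f)|f|^{-s}`, summed by degree. -/
def LFun (χ : Polynomial F → ℂ) (s : ℂ) : ℂ :=
  ∑' n : ℕ, (∑ᶠ f ∈ {f : Polynomial F | f.Monic ∧ f.natDegree = n}, χ f) *
    (Fintype.card F : ℂ) ^ (-(s * (n : ℂ)))

/-- Gauss sum `G(χ) = Σ_{deg a < deg ℓ} χ(a)·e(a/ℓ)`. -/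
def GSum (ℓ : Polynomial F) (χ : Polynomial F → ℂ) : ℂ :=
  ∑ᶠ a ∈ {a : Polynomial F | a.degree < ℓ.degree}, χ a * eFrac a ℓ

/-- Kloosterman sum over `F`. -/
def Kl2 (α β : F) : ℂ :=
  ∑ γ : Fˣ, eChar F (α * (γ : F) + β * ((γ⁻¹ : Fˣ) : F))

/-- Twisted Kloosterman sum over `F`. -/
def KlChi (χ : Polynomial F → ℂ) (α β : F) : ℂ :=
  ∑ γ : Fˣ, χ (Polynomial.C (γ : F)) * eChar F (α * (γ : F) + β * ((γ⁻¹ : Fˣ) : F))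

/-- Gauss sum of the restriction of `χ` to `F`. -/
def tauChi (χ : Polynomial F → ℂ) (α : F) : ℂ :=
  ∑ γ : Fˣ, χ (Polynomial.C (γ : F)) * eChar F (α * (γ : F))

/-- Generalized binomial coefficient `C(-m, j)`. -/
def negBinom (m j : ℕ) : ℤ :=
  if m = 0 then (if j = 0 then 1 else 0) else (-1) ^ j * (Nat.choose (m + j - 1) j)

/-- The coefficients `b_k(χ; λ, η₁, η₂)` of the Voronoi summation formula. -/
def bCoeff (χ : Polynomial F → ℂ) (lam : F) (η₁ η₂ k : ℕ) : ℂ :=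
  (-1 : ℂ) ^ (k - η₁ - η₂) * KlChi χ ((η₁ : F) - 1) ((1 - (η₂ : F)) * lam) *
    (if η₁ + η₂ ≤ k then (negBinom (η₁ + η₂) (k - η₁ - η₂) : ℂ) else 0)

/-- The untwisted coefficients `b_k(λ, η₁, η₂)`. -/
def bCoeffD (lam : F) (η₁ η₂ k : ℕ) : ℂ :=
  (-1 : ℂ) ^ (k - η₁ - η₂) * Kl2 ((η₁ : F) - 1) ((1 - (η₂ : F)) * lam) *
    (if η₁ + η₂ ≤ k then (negBinom (η₁ + η₂) (k - η₁ - η₂) : ℂ) else 0)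

/-- The series `Σ_{f monic} c(f)·u^{deg f}` (as a `tsum`). -/
def monicSeries (c : Polynomial F → ℂ) (u : ℂ) : ℂ :=
  ∑' f : {f : Polynomial F // f.Monic}, c f * u ^ (f : Polynomial F).natDegree

/-- `φ` is the rational continuation of the series `u ↦ Σ_{f monic} c(f)·u^{deg f}`:
it agrees with the (convergent) series on `‖u‖ < 1/q` and is a rational function. -/
def IsRatCont (c : Polynomial F → ℂ) (φ : ℂ → ℂ) : Prop :=
  (∃ P Q : Polynomial ℂ, IsCoprime P Q ∧ Q ≠ 0 ∧
    ∀ z : ℂ, Q.eval z ≠ 0 → φ z = P.eval z / Q.eval z) ∧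
  ∀ u : ℂ, ‖u‖ < 1 / (Fintype.card F) →
    HasSum (fun f : {f : Polynomial F // f.Monic} => c f * u ^ (f : Polynomial F).natDegree)
      (φ u)

end

theorem exists_primitive_addChar_eq_eChar (F : Type) [Field F] [Fintype F] :
    ∃ ψ : AddChar F ℂ, ψ.IsPrimitive ∧ ∀ y, eChar F y = ψ y := by
  let : Algebra (ZMod (ringChar F)) F := ZMod.algebra F (ringChar F)
  have : Fact (ringChar F).Prime := ⟨CharP.char_is_prime F _⟩
  refine ⟨ZMod.stdAddChar.compAddMonoidHom
    (Algebra.trace (ZMod (ringChar F)) F).toAddMonoidHom, ?_, fun y => ?_⟩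
  · refine AddChar.IsPrimitive.of_ne_one fun h => ?_
    obtain ⟨b, hb⟩ := FiniteField.trace_to_zmod_nondegenerate F (one_ne_zero (α := F))
    rw [one_mul] at hb
    refine hb (ZMod.injective_stdAddChar ?_)
    have := DFunLike.congr_fun h b
    simpa using this
  · simp only [AddChar.compAddMonoidHom_apply, ZMod.stdAddChar_apply, ZMod.toCircle_apply]
    rfl

theorem natDegree_X_pow_add_degreeLT {R : Type*} [Ring R] [Nontrivial R] {n : ℕ}
    (r : degreeLT R n) :
    (X ^ n + (r : R[X])).natDegree = n := by
  have h := mem_degreeLT.mp r.2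
  rw [natDegree_add_eq_left_of_degree_lt (by rwa [degree_X_pow]), natDegree_X_pow]

theorem hasSum_monic_congr {F : Type*} [Field F] {g : F[X]} (hg : g.Monic) (c : F[X])
    {u s : ℂ}
    (h : HasSum (fun f : {f : F[X] // f.Monic} => u ^ (f : F[X]).natDegree) s) :
    HasSum (fun f : {f : F[X] // f.Monic} =>
        (if (f : F[X]) % g = c % g then (1 : ℂ) else 0) * u ^ (f : F[X]).natDegree)
      ((if (c % g).Monic then u ^ (c % g).natDegree else 0) + u ^ g.natDegree * s) := by
  have hlt (f : F[X]) : (f % g).degree < g.degree := Polynomial.degree_mod_lt f hg.ne_zero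
  have hlt' {f : F[X]} (hf : f ≠ 0) : (c % g).degree < (g * f).degree :=
    (hlt c).trans_le (degree_le_mul_left g hf)
  have hmod (f : F[X]) : (c % g + g * f) % g = c % g := by
    rw [Polynomial.add_mod, (Polynomial.mod_eq_self_iff hg.ne_zero).mpr (hlt c)]
    simp
  let j : {f : F[X] // f.Monic} → {f : F[X] // f.Monic} := fun f =>
    ⟨c % g + g * f, (hg.mul f.2).add_of_right (hlt' f.2.ne_zero)⟩
  have hj : Function.Injective j := fun f₁ f₂ h12 => Subtype.ext <|
    mul_left_cancel₀ hg.ne_zero (add_left_cancel (congrArg Subtype.val h12))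
  have hjdeg (f : {f : F[X] // f.Monic}) :
      (j f : F[X]).natDegree = g.natDegree + (f : F[X]).natDegree := by
    rw [← hg.natDegree_mul f.2]
    exact natDegree_add_eq_right_of_degree_lt (hlt' f.2.ne_zero)
  have hlow : HasSum (fun f : {f : F[X] // f.Monic} =>
      if (f : F[X]) = c % g then u ^ (f : F[X]).natDegree else 0)
      (if (c % g).Monic then u ^ (c % g).natDegree else 0) := by
    split_ifs with hm
    · convert hasSum_ite_eq (⟨c % g, hm⟩ : {f : F[X] // f.Monic}) (u ^ (c % g).natDegree)
        using 2 with f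
      simp only [Subtype.ext_iff]
      split_ifs with hf
      · rw [hf]
      · rfl
    · convert hasSum_zero (α := ℂ) (β := {f : F[X] // f.Monic}) using 2 with f
      rw [if_neg]
      intro hf
      exact hm (hf ▸ f.2)
  have hhigh : HasSum (fun f : {f : F[X] // f.Monic} =>
      if f ∈ Set.range j then u ^ (f : F[X]).natDegree else 0) (u ^ g.natDegree * s) := by
    rw [← hj.hasSum_iff fun f hf => if_neg hf]
    refine Eq.subst (motive := fun φ => HasSum φ _) (funext fun f => ?_)
      (h.mul_left (u ^ g.natDegree))
    rw [Function.comp_apply, if_pos ⟨f, rfl⟩, hjdeg, pow_add]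
  convert hlow.add hhigh using 2 with f
  by_cases hf : (f : F[X]) % g = c % g
  · rw [if_pos hf, one_mul]
    have hdiv : c % g + g * ((f : F[X]) / g) = f := by
      rw [← hf]; exact EuclideanDomain.mod_add_div _ _
    by_cases h0 : (f : F[X]) / g = 0
    · rw [h0, mul_zero, add_zero] at hdiv
      rw [if_pos hdiv.symm, if_neg, add_zero]
      rintro ⟨f', rfl⟩
      have : (j f' : F[X]).degree < g.degree := by rw [← hdiv]; exact hlt c
      have h3 := natDegree_lt_natDegree (j f').2.ne_zero this
      rw [hjdeg] at h3
      omega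
    · have hmf : ((f : F[X]) / g).Monic := by
        have h1 : (f : F[X]).leadingCoeff = (g * ((f : F[X]) / g)).leadingCoeff := by
          conv_lhs => rw [← hdiv]
          exact leadingCoeff_add_of_degree_lt (hlt' h0)
        rw [leadingCoeff_mul, hg.leadingCoeff, one_mul, f.2.leadingCoeff] at h1
        exact h1.symm
      rw [if_neg, if_pos, zero_add]
      · exact ⟨⟨_, hmf⟩, Subtype.ext hdiv⟩
      · intro h1
        rw [h1] at hdiv
        have := add_eq_left.mp hdiv
        rw [h1] at h0
        exact (mul_ne_zero hg.ne_zero h0) this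
  · rw [if_neg hf, if_neg, if_neg]
    · simp
    · rintro ⟨f', rfl⟩
      exact hf (hmod f')
    · intro h1
      rw [h1] at hf
      exact hf ((Polynomial.mod_eq_self_iff hg.ne_zero).mpr (hlt c))

section

variable {F : Type} [Field F] [Fintype F]

theorem sum_units_addChar_mul {ψ : AddChar F ℂ} (hψ : ψ.IsPrimitive) (b : F) :
    ∑ x : Fˣ, ψ (x * b) = if b = 0 then (Fintype.card F : ℂ) - 1 else -1 := by
  have h := AddChar.sum_mulShift b hψ
  have h2 : ∑ x : F, ψ (x * b) = 1 + ∑ x : Fˣ, ψ (x * b) := by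
    rw [Fintype.sum_equiv unitsEquivNeZero (fun x : Fˣ => ψ (x * b))
      (fun x : {a : F // a ≠ 0} => ψ (x * b)) (fun x => rfl),
      ← Finset.sum_subtype (Finset.univ.erase (0 : F)) (by simp) (fun x => ψ (x * b)),
      ← Finset.add_sum_erase _ _ (Finset.mem_univ (0 : F))]
    simp
  rw [h2] at h
  rw [← sub_eq_of_eq_add' h.symm]
  split_ifs <;> simp

/-- A rational continuation agrees with every rational expression that represents it on the
disc of convergence, away from the zeros of the denominator. -/
theorem IsRatCont.eq_eval_div {w : F[X] → ℂ} {φ : ℂ → ℂ} (h : IsRatCont w φ) {A B : ℂ[X]}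
    (hAB : ∀ v : ℂ, ‖v‖ < 1 / Fintype.card F → B.eval v ≠ 0 → φ v = A.eval v / B.eval v)
    {z : ℂ} (hz : B.eval z ≠ 0) : φ z = A.eval z / B.eval z := by
  obtain ⟨⟨P, Q, hPQ, hQ, hφ⟩, -⟩ := h
  have hB : B ≠ 0 := by rintro rfl; simp at hz
  have key : P * B = A * Q := by
    have h0 : (P * B - A * Q) * (Q * B) = 0 := by
      refine eq_zero_of_infinite_isRoot _ (Set.Infinite.mono ?_
        (infinite_of_mem_nhds (0 : ℂ) (Metric.ball_mem_nhds 0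
          (ε := 1 / (Fintype.card F : ℝ)) (by have := Fintype.card_pos (α := F); positivity))))
      intro v hv
      rw [mem_ball_zero_iff] at hv
      simp only [Set.mem_ofPred_eq, IsRoot.def, eval_mul, eval_sub]
      by_cases hQv : Q.eval v = 0
      · simp [hQv]
      by_cases hBv : B.eval v = 0
      · simp [hBv]
      have := (hφ v hQv).symm.trans (hAB v hv hBv)
      rw [div_eq_div_iff hQv hBv] at this
      rw [this]
      simp
    exact sub_eq_zero.mp ((mul_eq_zero.mp h0).resolve_right (mul_ne_zero hQ hB))
  have hdvd : Q ∣ B := hPQ.symm.dvd_of_dvd_mul_left ⟨A, by rw [key, mul_comm]⟩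
  have hQz : Q.eval z ≠ 0 := fun h0 => hz (eval_eq_zero_of_dvd_of_eval_eq_zero hdvd h0)
  rw [hφ z hQz, div_eq_div_iff hQz hz]
  simpa using congrArg (eval z) key

noncomputable instance (n : ℕ) : Fintype (degreeLT F n) :=
  Fintype.ofEquiv _ (degreeLTEquiv F n).symm.toEquiv

theorem card_degreeLT (n : ℕ) : Fintype.card (degreeLT F n) = Fintype.card F ^ n := by
  rw [Fintype.card_congr (degreeLTEquiv F n).toEquiv]
  simp

/-- A monic polynomial is `X ^ n` plus a polynomial of degree less than `n`, for a unique `n`. -/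
noncomputable def monicEquivSigmaDegreeLT : (Σ n : ℕ, degreeLT F n) ≃ {f : F[X] // f.Monic} :=
  Equiv.ofBijective
    (fun p => ⟨X ^ p.1 + (p.2 : F[X]), monic_X_pow_add (mem_degreeLT.mp p.2.2)⟩) (by
    constructor
    · rintro ⟨n, r⟩ ⟨m, s⟩ h
      have h' : X ^ n + (r : F[X]) = X ^ m + (s : F[X]) := congrArg Subtype.val h
      obtain rfl : n = m := by
        rw [← natDegree_X_pow_add_degreeLT r, h', natDegree_X_pow_add_degreeLT]
      rw [Subtype.ext (add_left_cancel h')]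
    · rintro ⟨f, hf⟩
      refine ⟨⟨f.natDegree, f.eraseLead, mem_degreeLT.mpr ?_⟩, Subtype.ext ?_⟩
      · exact (degree_eraseLead_lt hf.ne_zero).trans_eq (degree_eq_natDegree hf.ne_zero)
      · have := f.eraseLead_add_monomial_natDegree_leadingCoeff
        rw [hf.leadingCoeff, monomial_one_right_eq_X_pow] at this
        exact (add_comm _ _).trans this)

theorem HasSum.by_natDegree {w : F[X] → ℂ} {v s : ℂ}
    (h : HasSum (fun f : {f : F[X] // f.Monic} => w f * v ^ (f : F[X]).natDegree) s) :
    HasSum (fun n : ℕ => (∑ r : degreeLT F n, w (X ^ n + (r : F[X]))) * v ^ n) s := by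
  refine HasSum.sigma (monicEquivSigmaDegreeLT.hasSum_iff.mpr h) fun n => ?_
  rw [Finset.sum_mul]
  convert hasSum_fintype (L := .unconditional _)
    (fun r : degreeLT F n => w (X ^ n + (r : F[X])) * v ^ n) using 2 with r
  have he : (monicEquivSigmaDegreeLT ⟨n, r⟩ : F[X]) = X ^ n + (r : F[X]) := rfl
  rw [Function.comp_apply, he, natDegree_X_pow_add_degreeLT]

theorem hasSum_pow_natDegree_monic {v : ℂ}
    (h : Summable fun f : {f : F[X] // f.Monic} => v ^ (f : F[X]).natDegree)
    (hv : Fintype.card F * ‖v‖ < 1) :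
    HasSum (fun f : {f : F[X] // f.Monic} => v ^ (f : F[X]).natDegree)
      (1 - Fintype.card F * v)⁻¹ := by
  have h1 := HasSum.by_natDegree (w := fun _ => 1) (by simpa only [one_mul] using h.hasSum)
  have h2 := hasSum_geometric_of_norm_lt_one (ξ := (Fintype.card F : ℂ) * v) (by simpa using hv)
  have h3 : (fun n : ℕ => (∑ _r : degreeLT F n, (1 : ℂ)) * v ^ n) =
      fun n : ℕ => ((Fintype.card F : ℂ) * v) ^ n := by
    funext n
    simp [card_degreeLT, mul_pow]
  rw [h3] at h1
  rw [← h1.unique h2]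
  exact h.hasSum

theorem sum_addChar_X_pow_add {ψ : AddChar F ℂ} (L : F[X] →ₗ[F] F) {n : ℕ}
    (hL : ∀ r ∈ degreeLT F n, L r = 0) :
    ∑ r : degreeLT F n, ψ (L (X ^ n + (r : F[X]))) = Fintype.card F ^ n * ψ (L (X ^ n)) := by
  have h (r : degreeLT F n) : L (X ^ n + (r : F[X])) = L (X ^ n) := by
    rw [map_add, hL r r.2, add_zero]
  simp [h, card_degreeLT]

theorem sum_addChar_X_pow_add_eq_zero {ψ : AddChar F ℂ} (hψ : ψ.IsPrimitive)
    (L : F[X] →ₗ[F] F) {n : ℕ} {r₀ : F[X]} (hr₀ : r₀ ∈ degreeLT F n) (hL : L r₀ ≠ 0) :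
    ∑ r : degreeLT F n, ψ (L (X ^ n + (r : F[X]))) = 0 := by
  simp only [map_add, AddChar.map_add_eq_mul, ← Finset.mul_sum]
  refine mul_eq_zero_of_right _ ?_
  refine AddChar.sum_eq_zero_of_ne_one
    (ψ := ψ.compAddMonoidHom (L.comp (degreeLT F n).subtype).toAddMonoidHom) fun h => ?_
  refine hψ one_ne_zero (DFunLike.ext _ _ fun y => ?_)
  have := DFunLike.congr_fun h ((y / L r₀) • (⟨r₀, hr₀⟩ : degreeLT F n))
  simpa [hL] using this

/-- For `g ∤ c`, the series `D₁(v; λc/g)` is a polynomial in `v`. -/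
theorem eq_of_hasSum_eFrac {ψ : AddChar F ℂ} (hψ : ψ.IsPrimitive)
    (hψe : ∀ y, eChar F y = ψ y) {g c : F[X]} (hg : g.Monic) (hc : c % g ≠ 0) {k : ℕ}
    (hk : g.natDegree = (c % g).natDegree + k + 1) {lam : Fˣ} {v s : ℂ}
    (h : HasSum (fun f : {f : F[X] // f.Monic} =>
      eFrac (Polynomial.C (lam : F) * c * (f : F[X])) g * v ^ (f : F[X]).natDegree) s) :
    s = ∑ n ∈ Finset.range k, ((Fintype.card F : ℂ) * v) ^ n +
      ((Fintype.card F : ℂ) * v) ^ k * ψ (lam * (c % g).leadingCoeff) := by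
  let L : F[X] →ₗ[F] F := lcoeff F (g.natDegree - 1) ∘ₗ modByMonicHom g ∘ₗ
    LinearMap.mulLeft F (Polynomial.C (lam : F) * c)
  have hLe (f : F[X]) : eFrac (Polynomial.C (lam : F) * c * f) g = ψ (L f) := by
    rw [eFrac, hψe, ← modByMonic_eq_mod _ hg]
    rfl
  have hLk {f : F[X]} (hf : f.natDegree ≤ k) :
      L f = lam * (c % g).leadingCoeff * f.coeff k := by
    have h1 : (Polynomial.C (lam : F) * c * f) % g = Polynomial.C (lam : F) * ((c % g) * f) := by
      have hlt : ((c % g) * f).degree < g.degree := by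
        refine degree_lt_degree ?_
        have := natDegree_mul_le (p := c % g) (q := f)
        omega
      have hcf : c * f % g = (c % g) * f := by
        refine Eq.trans ?_ ((Polynomial.mod_eq_self_iff hg.ne_zero).mpr hlt)
        rw [Polynomial.mul_mod c f g, Polynomial.mul_mod (c % g) f g,
          (Polynomial.mod_eq_self_iff hg.ne_zero).mpr (Polynomial.degree_mod_lt c hg.ne_zero)]
      rw [mul_assoc, ← smul_eq_C_mul, ← smul_eq_C_mul, ← modByMonic_eq_mod _ hg,
        smul_modByMonic, modByMonic_eq_mod _ hg, hcf]
    simp only [L, LinearMap.comp_apply, LinearMap.mulLeft_apply, modByMonicHom_apply,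
      modByMonic_eq_mod _ hg, h1, lcoeff_apply, coeff_C_mul]
    rw [show g.natDegree - 1 = (c % g).natDegree + k by omega,
      coeff_mul_add_eq_of_natDegree_le le_rfl hf, coeff_natDegree, mul_assoc]
  have hLlt {n : ℕ} (hn : n ≤ k) : ∀ r ∈ degreeLT F n, L r = 0 := by
    intro r hr
    have h1 : r.degree < k := (mem_degreeLT.mp hr).trans_le (by exact_mod_cast hn)
    rw [hLk (natDegree_le_of_degree_le h1.le), coeff_eq_zero_of_degree_lt h1, mul_zero]
  have hLX : L (X ^ k) = lam * (c % g).leadingCoeff := by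
    rw [hLk (by simp)]
    simp
  have hLX0 : L (X ^ k) ≠ 0 := by
    rw [hLX]
    exact mul_ne_zero lam.ne_zero (leadingCoeff_ne_zero.mpr hc)
  simp only [hLe] at h
  have hs := HasSum.by_natDegree (w := fun f => ψ (L f)) h
  have hfin := hasSum_sum_of_ne_finset_zero (L := .unconditional _)
    (f := fun n : ℕ => (∑ r : degreeLT F n, ψ (L (X ^ n + (r : F[X])))) * v ^ n)
    (s := Finset.range (k + 1)) (fun n hn => by
      have hkn : k < n := by simpa [Nat.lt_succ_iff] using hn
      rw [sum_addChar_X_pow_add_eq_zero hψ L (r₀ := X ^ k) _ hLX0, zero_mul]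
      rw [mem_degreeLT, degree_X_pow]
      exact_mod_cast hkn)
  rw [hs.unique hfin, Finset.sum_range_succ, sum_addChar_X_pow_add L (hLlt le_rfl), hLX]
  congr 1
  · refine Finset.sum_congr rfl fun n hn => ?_
    have hn' := Finset.mem_range.mp hn
    rw [sum_addChar_X_pow_add L (hLlt hn'.le), hLlt le_rfl, AddChar.map_zero_eq_one, mul_one,
      mul_pow]
    rw [mem_degreeLT, degree_X_pow]
    exact_mod_cast hn'
  · rw [mul_pow]
    ring

end

/-- **Functional equation of the Hurwitz zeta function over `𝔽_q[T]`:**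
for `0 < |u| < 1/q`,
`Z(u;c,g) = u^{deg g - 1} Σ_{λ ∈ F^×} [e_q(-λ)/q - 1/(q(1-qu))]·D_1(1/(qu); λc/g)`,
where `D_1` is evaluated via its rational continuation. -/
theorem hurwitzZeta_functional_equation
    (F : Type) [Field F] [Fintype F] (q : ℕ) (hq : q = Fintype.card F)
    (g : Polynomial F) (hg : g.Monic) (c : Polynomial F)
    (φD : Fˣ → ℂ → ℂ)
    (hφD : ∀ lam : Fˣ,
      IsRatCont (fun f => eFrac (Polynomial.C (lam : F) * c * f) g) (φD lam))
    (u : ℂ) (hu0 : 0 < ‖u‖) (hu : ‖u‖ < 1 / q) :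
    monicSeries (fun f => if f % g = c % g then (1 : ℂ) else 0) u =
      u ^ ((g.natDegree : ℤ) - 1) *
        ∑ lam : Fˣ,
          (eChar F (-(lam : F)) / (q : ℂ) - 1 / ((q : ℂ) * (1 - (q : ℂ) * u))) *
            φD lam (1 / ((q : ℂ) * u)) := by
  subst hq
  have hq1 : (1 : ℝ) < Fintype.card F := by exact_mod_cast Fintype.one_lt_card (α := F)
  have hq0 : (Fintype.card F : ℂ) ≠ 0 := by simp
  have hu0' : u ≠ 0 := norm_pos_iff.mp hu0
  have hu1 : u ≠ 1 := by
    rintro rfl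
    rw [norm_one, lt_div_iff₀ (by linarith)] at hu
    linarith
  have hqu : 1 - (Fintype.card F : ℂ) * u ≠ 0 := by
    intro h
    have h1 : (Fintype.card F : ℂ) * u = 1 := (sub_eq_zero.mp h).symm
    have h2 : (Fintype.card F : ℝ) * ‖u‖ = 1 := by
      simpa using congrArg norm h1
    rw [lt_div_iff₀ (by linarith)] at hu
    linarith
  obtain ⟨ψ, hψ, hψe⟩ := exists_primitive_addChar_eq_eChar F
  have hsummable : ∀ v : ℂ, ‖v‖ < 1 / Fintype.card F →
      Summable fun f : {f : F[X] // f.Monic} => v ^ (f : F[X]).natDegree := by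
    intro v hv
    refine Summable.of_norm_bounded ((hφD 1).2 v hv).summable.norm fun f => ?_
    simp only [eFrac, hψe, norm_mul, AddChar.norm_apply, one_mul, le_refl]
  have hzeta := hasSum_pow_natDegree_monic (hsummable u hu)
    (by rwa [lt_div_iff₀ (by linarith), mul_comm] at hu)
  have hZ := hasSum_monic_congr hg c hzeta
  rw [monicSeries, hZ.tsum_eq]
  simp only [hψe]
  have hneg : ∑ lam : Fˣ, ψ (-(lam : F)) = -1 := by
    have h := sum_units_addChar_mul hψ (-1)
    simpa using h
  have hconst (a : ℂ) : ∑ _lam : Fˣ, a = ((Fintype.card F : ℂ) - 1) * a := by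
    rw [Finset.sum_const, Finset.card_univ, Fintype.card_units, nsmul_eq_mul,
      Nat.cast_sub Fintype.card_pos, Nat.cast_one]
  by_cases hc : c % g = 0
  · have hD (lam : Fˣ) : φD lam (1 / (Fintype.card F * u)) = u / (u - 1) := by
      have h := (hφD lam).eq_eval_div (A := 1)
        (B := 1 - Polynomial.C (Fintype.card F : ℂ) * X) ?_
        (z := 1 / (Fintype.card F * u)) ?_
      · rw [h]
        have := sub_ne_zero.mpr hu1
        simp only [eval_one, eval_sub, eval_mul, eval_C, eval_X]
        field_simp
      · intro v hv _
        have h1 := hasSum_pow_natDegree_monic (hsummable v hv)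
          (by rwa [lt_div_iff₀ (by linarith), mul_comm] at hv)
        have h2 := (hφD lam).2 v hv
        have h3 : ∀ f : F[X], eFrac (Polynomial.C (lam : F) * c * f) g = 1 := by
          intro f
          rw [eFrac, hψe, mul_right_comm, Polynomial.mul_mod, hc]
          simp
        simp only [h3, one_mul] at h2
        rw [h2.unique h1]
        simp
      · simp only [eval_one, eval_sub, eval_mul, eval_C, eval_X]
        have := sub_ne_zero.mpr hu1
        field_simp
        exact div_ne_zero this hu0'
    simp only [hD]
    rw [← Finset.sum_mul, Finset.sum_sub_distrib, ← Finset.sum_div, hneg, hconst,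
      if_neg (by rw [hc]; exact fun h => h.ne_zero rfl), zpow_sub_one₀ hu0', zpow_natCast]
    have := sub_ne_zero.mpr hu1
    field_simp
    ring
  · obtain ⟨k, hk⟩ : ∃ k, g.natDegree = (c % g).natDegree + k + 1 := by
      have : (c % g).natDegree < g.natDegree :=
        natDegree_lt_natDegree hc (Polynomial.degree_mod_lt c hg.ne_zero)
      exact ⟨g.natDegree - (c % g).natDegree - 1, by omega⟩
    set a := (c % g).leadingCoeff with ha
    have hD (lam : Fˣ) : φD lam (1 / (Fintype.card F * u)) =
        (u⁻¹ ^ k - 1) / (u⁻¹ - 1) + u⁻¹ ^ k * ψ (lam * a) := by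
      have h := (hφD lam).eq_eval_div
        (A := ∑ n ∈ Finset.range k, (Polynomial.C (Fintype.card F : ℂ) * X) ^ n +
          (Polynomial.C (Fintype.card F : ℂ) * X) ^ k * Polynomial.C (ψ (lam * a)))
        (B := 1) ?_ (z := 1 / (Fintype.card F * u)) (by simp)
      · have h1 : (Fintype.card F : ℂ) * (1 / (Fintype.card F * u)) = u⁻¹ := by
          field_simp
        rw [h]
        simp only [eval_one, eval_add, eval_mul, eval_C, eval_X, eval_pow, eval_finsetSum, h1,
          div_one]
        rw [geom_sum_eq (by simpa using hu1)]
      · intro v hv _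
        rw [eq_of_hasSum_eFrac hψ hψe hg hc hk ((hφD lam).2 v hv)]
        simp [eval_finsetSum, a]
    simp only [hD]
    have hshift : ∑ lam : Fˣ, ψ (-(lam : F)) * ψ (lam * a) =
        if a = 1 then (Fintype.card F : ℂ) - 1 else -1 := by
      have h := sum_units_addChar_mul hψ (a - 1)
      simp only [sub_eq_zero] at h
      rw [← h]
      refine Finset.sum_congr rfl fun lam _ => ?_
      rw [← AddChar.map_add_eq_mul]
      congr 1
      ring
    have hshift' : ∑ lam : Fˣ, ψ (lam * a) = -1 := by
      rw [sum_units_addChar_mul hψ, if_neg (leadingCoeff_ne_zero.mpr hc)]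
    have hmonic : (c % g).Monic ↔ a = 1 := Iff.rfl
    have hdiff : u⁻¹ - 1 ≠ 0 := sub_ne_zero.mpr (by simpa using hu1)
    have hdiff' : 1 - u ≠ 0 := sub_ne_zero.mpr hu1.symm
    have hgeom : (u⁻¹ ^ k - 1) / (u⁻¹ - 1) = (u - u * u ^ k) / (u ^ k * (1 - u)) := by
      rw [inv_pow]
      field_simp
    have hexp : u ^ ((g.natDegree : ℤ) - 1) = u ^ (c % g).natDegree * u ^ k := by
      rw [← pow_add, ← zpow_natCast, hk]
      congr 1
      push_cast
      ring
    have hsum (G w K : ℂ) : ∑ lam : Fˣ,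
        (ψ (-(lam : F)) / (Fintype.card F : ℂ) - K) * (G + w * ψ (lam * a)) =
          -(G / Fintype.card F) - (Fintype.card F - 1) * (K * G) +
          (if a = 1 then (Fintype.card F : ℂ) - 1 else -1) * (w / Fintype.card F) + w * K := by
      have hterm (lam : Fˣ) :
          (ψ (-(lam : F)) / (Fintype.card F : ℂ) - K) * (G + w * ψ (lam * a)) =
            ψ (-(lam : F)) * (G / Fintype.card F) - K * G +
            ψ (-(lam : F)) * ψ (lam * a) * (w / Fintype.card F) - ψ (lam * a) * (w * K) := by
        ring
      simp only [hterm, Finset.sum_add_distrib, Finset.sum_sub_distrib, ← Finset.sum_mul,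
        hneg, hshift, hshift', hconst]
      ring
    rw [hsum, hgeom, hexp, inv_pow, hk, if_congr hmonic rfl rfl]
    split_ifs <;> field_simp <;> ring
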